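/- For every integer t ≥ 1 and every real ε > 0, there exists a finite connected graph G with maximum degree 3 and 2t ≤ |V(G)| such that player B has a single strategy in the t-round discrete Voronoi game on G with the following property: for every k = 1, …, t, after both players have placed their k-th pebbles, if the unclaimed vertices were divided according to the Voronoi rule at that moment, B's score would be at least (1 − ε)·|V(G)|. -/

import Mathlib

open SimpleGraph

variable {V : Type*}

/-- Distance from a vertex to a finite set of vertices (`⊤` if the set is empty). -/
noncomputable def distToSet (G : SimpleGraph V) (S : Finset V) (v : V) : ℕ∞ :=
  S.inf fun a => (G.dist a v : ℕ∞)

/-- Player A's Voronoi score. -/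
noncomputable def scoreA [Fintype V] (G : SimpleGraph V) (A B : Finset V) : ℝ :=
  ∑ v : V,
    if distToSet G A v < distToSet G B v then 1
    else if distToSet G A v = distToSet G B v then 1/2 else 0

/-- Player B's Voronoi score. -/
noncomputable def scoreB [Fintype V] (G : SimpleGraph V) (A B : Finset V) : ℝ :=
  ∑ v : V,
    if distToSet G B v < distToSet G A v then 1
    else if distToSet G B v = distToSet G A v then 1/2 else 0

/-- Minimax value (A's score under optimal play) of the Voronoi game with `t`
remaining rounds, given the sets of vertices already claimed by A and B. -/
noncomputable def gameValue [Fintype V] [DecidableEq V] (G : SimpleGraph V) :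
    ℕ → Finset V → Finset V → ℝ
  | 0, A, B => scoreA G A B
  | (t+1), A, B =>
      sSup {r : ℝ | ∃ a, a ∉ A ∧ a ∉ B ∧
        r = sInf {s : ℝ | ∃ b, b ∉ insert a A ∧ b ∉ B ∧
          s = gameValue G t (insert a A) (insert b B)}}

/-- The Voronoi ratio of `G` for a `t`-round game. -/
noncomputable def VR [Fintype V] [DecidableEq V] (G : SimpleGraph V) (t : ℕ) : ℝ :=
  gameValue G t ∅ ∅ / (Fintype.card V)

/-- The history of the game after A's `(k+1)`-st move, when A plays the sequence `a`
and B plays according to the strategy `σ` (which maps a history, a list of all moves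
made so far with A moving first, to B's next move). -/
def histList (σ : List V → V) (a : ℕ → V) : ℕ → List V
  | 0 => [a 0]
  | (k + 1) => histList σ a k ++ [σ (histList σ a k), a (k + 1)]

/-- B's `(k+1)`-st move when following strategy `σ` against A's sequence of moves `a`. -/
def bMove (σ : List V → V) (a : ℕ → V) (k : ℕ) : V :=
  σ (histList σ a k)

/-- The vertices: connecting paths, and clusters. -/
abbrev VG (d M : ℕ) : Type := (ZMod d × ZMod d × Fin (d * d + 1)) ⊕ (ZMod d × Fin M)

def relG (d M : ℕ) : VG d M → VG d M → Prop
  | .inl (i, j, y), .inl (i', j', y') =>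
      i = i' ∧ ((j = j' ∧ y.val + 1 = y'.val) ∨ (j' = j + 1 ∧ y.val = 0 ∧ y'.val = 0))
  | .inl (i, j, y), .inr (k, s) => k = j ∧ y.val = d * d ∧ s.val = d * (i - j).val
  | .inr (k, s), .inr (k', s') => k = k' ∧ s.val + 1 = s'.val
  | .inr _, .inl _ => False

def graphG (d M : ℕ) : SimpleGraph (VG d M) := SimpleGraph.fromRel (relG d M)

theorem lip_dist {V : Type*} (G : SimpleGraph V) (hG : G.Connected) (g : V → ℤ)
    (hg : ∀ x y, G.Adj x y → g x ≤ g y + 1) (x y : V) : g x ≤ g y + G.dist x y := by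
  obtain ⟨w, hw⟩ := hG.exists_walk_length_eq_dist x y
  rw [← hw]
  clear hw
  induction w with
  | nil => simp
  | cons h p ih =>
    have := hg _ _ h
    simp only [SimpleGraph.Walk.length_cons]
    push_cast
    linarith

theorem adj_step {d M : ℕ} {x y : VG d M} (h : relG d M x y) (hne : x ≠ y) :
    (graphG d M).Adj x y := by
  simp [graphG, SimpleGraph.fromRel_adj, h, hne]

theorem walk_cluster {d M : ℕ} (k : ZMod d) (n : ℕ) : ∀ (s s' : Fin M), s.val + n = s'.val →
    ∃ w : (graphG d M).Walk (.inr (k, s)) (.inr (k, s')), w.length = n := by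
  induction n with
  | zero =>
    intro s s' h
    obtain rfl : s = s' := Fin.ext (by simpa using h)
    exact ⟨.nil, rfl⟩
  | succ n ih =>
    intro s s' h
    have h1 : s.val + 1 < M := by have := s'.2; omega
    obtain ⟨w, hw⟩ := ih ⟨s.val + 1, h1⟩ s' (by simp; omega)
    refine ⟨.cons (adj_step ?_ ?_) w, by simp [hw]⟩
    · simp [relG]
    · simp [Fin.ext_iff]

theorem walk_path {d M : ℕ} (i j : ZMod d) (n : ℕ) :
    ∀ (s s' : Fin (d * d + 1)), s.val + n = s'.val →
    ∃ w : (graphG d M).Walk (.inl (i, j, s)) (.inl (i, j, s')), w.length = n := by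
  induction n with
  | zero =>
    intro s s' h
    obtain rfl : s = s' := Fin.ext (by simpa using h)
    exact ⟨.nil, rfl⟩
  | succ n ih =>
    intro s s' h
    have h1 : s.val + 1 < d * d + 1 := by have := s'.2; omega
    obtain ⟨w, hw⟩ := ih ⟨s.val + 1, h1⟩ s' (by simp; omega)
    refine ⟨.cons (adj_step ?_ ?_) w, by simp [hw]⟩
    · simp [relG]
    · simp [Fin.ext_iff]

theorem walk_spine {d M : ℕ} (hd : 2 ≤ d) (i : ZMod d) (n : ℕ) : ∀ j j' : ZMod d, j + n = j' →
    ∃ w : (graphG d M).Walk (.inl (i, j, 0)) (.inl (i, j', 0)), w.length = n := by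
  induction n with
  | zero =>
    intro j j' h
    obtain rfl : j = j' := by simpa using h
    exact ⟨.nil, rfl⟩
  | succ n ih =>
    intro j j' h
    obtain ⟨w, hw⟩ := ih (j + 1) j' (by rw [← h]; push_cast; ring)
    have : Fact (1 < d) := ⟨hd⟩
    refine ⟨.cons (adj_step ?_ ?_) w, by simp [hw]⟩
    · simp [relG]
    · simp

theorem tooth_lt {d : ℕ} [NeZero d] (x : ZMod d) : d * x.val < d * d :=
  Nat.mul_lt_mul_of_pos_left (ZMod.val_lt x) (Nat.pos_of_ne_zero (NeZero.ne d))

theorem dist_base_le {d M : ℕ} [NeZero d] (hd : 2 ≤ d) (i k : ZMod d) (s : Fin M)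
    (hs : d * d ≤ s.val) :
    (graphG d M).dist (.inl (i, 0, 0)) (.inr (k, s)) + d * (i - k).val ≤ d + d * d + s.val := by
  have h0 := tooth_lt (i - k)
  obtain ⟨w1, h1⟩ := walk_spine (M := M) hd i k.val 0 k (by simp)
  obtain ⟨w2, h2⟩ := walk_path (M := M) i k (d * d) 0 (Fin.last _) (by simp)
  obtain ⟨w3, h3⟩ := walk_cluster k (s.val - d * (i - k).val)
    ⟨d * (i - k).val, by have := s.2; omega⟩ s (by simp only; omega)
  have ha : (graphG d M).Adj (.inl (i, k, Fin.last _))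
      (.inr (k, ⟨d * (i - k).val, by have := s.2; omega⟩)) :=
    adj_step (by simp [relG]) (by simp)
  have := SimpleGraph.dist_le (w1.append (w2.append (.cons ha w3)))
  simp only [SimpleGraph.Walk.length_append, SimpleGraph.Walk.length_cons, h1, h2, h3] at this
  have hk := ZMod.val_lt k
  omega

theorem connG {d M : ℕ} [NeZero d] (hd : 2 ≤ d) (hM : d * d ≤ M) : (graphG d M).Connected := by
  have hE : ∀ i j y, (graphG d M).Reachable (.inl (i, j, 0)) (.inl (i, j, y)) := fun i j y =>
    (walk_path (M := M) i j y.val 0 y (by simp)).nonempty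
  have hS : ∀ i j, (graphG d M).Reachable (.inl (i, 0, 0)) (.inl (i, j, 0)) := fun i j =>
    (walk_spine (M := M) hd i j.val 0 j (by simp)).nonempty
  have hpos : 0 < M := by nlinarith
  have hC : ∀ k s, (graphG d M).Reachable (.inr (k, ⟨0, hpos⟩)) (.inr (k, s)) := fun k s =>
    (walk_cluster k s.val _ _ (by simp)).nonempty
  have hX : ∀ i k, (graphG d M).Reachable (.inl (i, k, 0)) (.inr (k, ⟨0, hpos⟩)) := fun i k => by
    have h0 := tooth_lt (i - k)
    have ha : (graphG d M).Adj (.inl (i, k, Fin.last _))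
      (.inr (k, ⟨d * (i - k).val, by omega⟩)) :=
      adj_step (by simp [relG]) (by simp)
    exact (hE i k _).trans (ha.reachable.trans (hC k _).symm)
  have hR : ∀ x, (graphG d M).Reachable (.inl (0, 0, 0)) x := by
    rintro (⟨i, j, y⟩ | ⟨k, s⟩)
    · exact (hX 0 0).trans ((hX i 0).symm.trans ((hS i j).trans (hE i j y)))
    · exact (hS 0 k).trans ((hX 0 k).trans (hC k s))
  have : Nonempty (VG d M) := ⟨.inl (0, 0, 0)⟩
  exact ⟨fun x y => (hR x).symm.trans (hR y)⟩

theorem ncard_le_three {V : Type*} (S : Set V) (x y z : V)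
    (h : ∀ w ∈ S, w = x ∨ w = y ∨ w = z) : S.ncard ≤ 3 := by
  have : S ⊆ {x, y, z} := fun w hw => by simpa using h w hw
  exact (Set.ncard_le_ncard this (by simp)).trans (by
    refine (Set.ncard_insert_le _ _).trans ?_
    have := Set.ncard_insert_le y {z}
    simp at this
    omega)

theorem degG {d M : ℕ} [NeZero d] (hd : 2 ≤ d) (hM : d * d ≤ M) (v : VG d M) :
    ((graphG d M).neighborSet v).ncard ≤ 3 := by
  rcases v with ⟨i, j, y⟩ | ⟨k, s⟩
  · have h0 := tooth_lt (i - j)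
    have hdd : 0 < d * d := by nlinarith
    refine ncard_le_three _
      (if h : y.val < d * d then .inl (i, j, ⟨y.val + 1, by omega⟩)
        else .inr (j, ⟨d * (i - j).val, by omega⟩))
      (if y.val = 0 then .inl (i, j + 1, 0) else .inl (i, j, ⟨y.val - 1, by omega⟩))
      (.inl (i, j - 1, 0)) ?_
    rintro (⟨i', j', y'⟩ | ⟨k', s'⟩) hw
    · simp only [SimpleGraph.mem_neighborSet, graphG, SimpleGraph.fromRel_adj, relG] at hw
      obtain ⟨-, ⟨rfl, ⟨rfl, h⟩ | ⟨rfl, h, h'⟩⟩ | ⟨rfl, ⟨rfl, h⟩ | ⟨rfl, h, h'⟩⟩⟩ := hw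
      · left
        rw [dif_pos (by have := y'.2; omega)]
        simp [Fin.ext_iff, h]
      · right; left
        rw [if_pos h]
        simp [Fin.ext_iff, h']
      · right; left
        rw [if_neg (by omega)]
        simp [Fin.ext_iff, ← h]
      · right; right
        simp [Fin.ext_iff, h]
    · simp only [SimpleGraph.mem_neighborSet, graphG, SimpleGraph.fromRel_adj, relG] at hw
      obtain ⟨-, ⟨rfl, h, h'⟩ | h⟩ := hw
      · left
        rw [dif_neg (by omega)]
        simp [Fin.ext_iff, h']
      · exact h.elim
  · refine ncard_le_three _
      (if h : s.val + 1 < M then .inr (k, ⟨s.val + 1, h⟩) else .inr (k, s))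
      (.inr (k, ⟨s.val - 1, by omega⟩))
      (.inl (k + (s.val / d : ℕ), k, Fin.last _)) ?_
    rintro (⟨i', j', y'⟩ | ⟨k', s'⟩) hw
    · simp only [SimpleGraph.mem_neighborSet, graphG, SimpleGraph.fromRel_adj, relG] at hw
      obtain ⟨-, h | ⟨rfl, h, h'⟩⟩ := hw
      · exact h.elim
      · right; right
        rw [h', Nat.mul_div_cancel_left _ (by omega)]
        simp [Fin.ext_iff, h]
    · simp only [SimpleGraph.mem_neighborSet, graphG, SimpleGraph.fromRel_adj, relG] at hw
      obtain ⟨-, ⟨rfl, h⟩ | ⟨rfl, h⟩⟩ := hw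
      · left
        rw [dif_pos (by have := s'.2; omega)]
        simp [Fin.ext_iff, h]
      · right; left
        simp [Fin.ext_iff, ← h]

theorem deg_eqG {d M : ℕ} [NeZero d] (hd : 3 ≤ d) (hM : d * d ≤ M) :
    ((graphG d M).neighborSet (.inl (0, 0, 0))).ncard = 3 := by
  refine le_antisymm (degG (by omega) hM _) ?_
  have hdd : 1 < d * d + 1 := by nlinarith
  have : Fact (1 < d) := ⟨by omega⟩
  have hne : (1 : ZMod d) ≠ -1 := by
    intro h
    have h2 : ((2 : ℕ) : ZMod d) = 0 := by
      have : (1 : ZMod d) + 1 = 0 := by nth_rewrite 1 [h]; ring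
      push_cast; rw [← this]; norm_num
    rw [ZMod.natCast_eq_zero_iff] at h2
    have := Nat.le_of_dvd (by norm_num) h2
    omega
  have hsub : ({.inl (0, 0, ⟨1, hdd⟩), .inl (0, 1, 0), .inl (0, -1, 0)} : Set (VG d M)) ⊆
      (graphG d M).neighborSet (.inl (0, 0, 0)) := by
    rintro w (rfl | rfl | rfl)
    · exact adj_step (by simp [relG]) (by simp [Fin.ext_iff])
    · exact adj_step (by simp [relG]) (by simp)
    · exact (adj_step (by simp [relG]) (by simp)).symm
  refine le_trans (le_of_eq ?_) (Set.ncard_le_ncard hsub (Set.toFinite _))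
  rw [Set.ncard_insert_of_notMem, Set.ncard_pair]
  · simpa using hne
  · simp

/-- Potential bounding from below the distance to the vertex at depth `s` in cluster `k`. -/
def potG (d M : ℕ) (k : ZMod d) (s : ℕ) : VG d M → ℤ
  | .inl (i, j, y) =>
      if j = k then (s : ℤ) - d * (i - k).val + (d * d + 1) - y.val
      else min (s + d * d + 1 : ℤ) ((s : ℤ) - d * (i - k).val + (d * d + 1) + y.val)
  | .inr (j, x) => if j = k then (s : ℤ) - x.val else s + d * d + 1

theorem potG_rel {d M : ℕ} [NeZero d] (k : ZMod d) (s : ℕ) (x y : VG d M) (h : relG d M x y) :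
    potG d M k s x ≤ potG d M k s y + 1 ∧ potG d M k s y ≤ potG d M k s x + 1 := by
  rcases x with ⟨i, j, u⟩ | ⟨j, x⟩ <;> rcases y with ⟨i', j', y'⟩ | ⟨j', x'⟩
  · simp only [relG] at h
    have h0 := tooth_lt (i - k)
    have hnn : (0 : ℤ) ≤ d * (i - k).val := by positivity
    zify at h0
    obtain ⟨rfl, ⟨rfl, h⟩ | ⟨rfl, h, h'⟩⟩ := h
    · simp only [potG]
      split_ifs <;> omega
    · simp only [potG, h, h']
      split_ifs <;> omega
  · simp only [relG] at h
    obtain ⟨rfl, h, h'⟩ := h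
    have h0 := tooth_lt (i - k)
    have hnn : (0 : ℤ) ≤ d * (i - k).val := by positivity
    zify at h0
    simp only [potG, h, h']
    split_ifs with hh
    · subst hh
      push_cast
      omega
    · push_cast
      omega
  · simp [relG] at h
  · simp only [relG] at h
    obtain ⟨rfl, h⟩ := h
    simp only [potG]
    split_ifs <;> omega

theorem dist_lower {d M : ℕ} [NeZero d] (hd : 2 ≤ d) (hM : d * d ≤ M) (a : VG d M) :
    ∃ i j : ZMod d, ∀ k, k ≠ j → ∀ s : Fin M,
      s.val + d * d + 1 ≤ (graphG d M).dist a (.inr (k, s)) + d * (i - k).val := by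
  have key : ∀ k (s : Fin M), potG d M k s.val a ≤ (graphG d M).dist a (.inr (k, s)) := by
    intro k s
    have := lip_dist (graphG d M) (connG hd hM) (potG d M k s.val) (by
      intro x y h
      rw [graphG, SimpleGraph.fromRel_adj] at h
      rcases h.2 with h | h
      · exact (potG_rel k s.val x y h).1
      · exact (potG_rel k s.val y x h).2) a (.inr (k, s))
    simpa [potG] using this
  rcases a with ⟨i, j, y⟩ | ⟨j, x⟩
  · refine ⟨i, j, fun k hk s => ?_⟩
    have := key k s
    simp only [potG, if_neg (Ne.symm hk)] at this
    zify
    have h0 := tooth_lt (i - k)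
    zify at h0
    have : (0 : ℤ) ≤ d * (i - k).val := by positivity
    omega
  · refine ⟨0, j, fun k hk s => ?_⟩
    have := key k s
    simp only [potG, if_neg (Ne.symm hk)] at this
    zify
    have : (0 : ℤ) ≤ d * (0 - k).val := by positivity
    omega

theorem coreG (m d M : ℕ) [NeZero d] (hd : m + 3 ≤ d) (hM : d * d ≤ M) (a : VG d M)
    (F : Finset (VG d M)) (hF : F.card ≤ m) :
    ∃ b, b ∉ F ∧ ({v | ¬ (graphG d M).dist b v < (graphG d M).dist a v} : Set (VG d M)).ncard ≤
      (m + 2) * M + d * (d * d) + d * d * (d * d + 1) := by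
  classical
  obtain ⟨i, j, hij⟩ := dist_lower (by omega) hM a
  obtain ⟨b, hb, hbF⟩ := Finset.exists_mem_notMem_of_card_lt_card (s := F)
    (t := (Finset.Icc 1 (m + 1)).image
      (fun r : ℕ => (.inl (i + (r : ZMod d), 0, 0) : VG d M))) (by
    rw [Finset.card_image_of_injOn]
    · simp; omega
    · intro r hr r' hr' h
      simp only [Finset.coe_Icc, Set.mem_Icc] at hr hr'
      simp only [Sum.inl.injEq, Prod.mk.injEq, add_right_inj, and_true] at h
      have := congrArg ZMod.val h
      rwa [ZMod.val_natCast_of_lt (by omega), ZMod.val_natCast_of_lt (by omega)] at this)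
  refine ⟨b, hbF, ?_⟩
  simp only [Finset.mem_image, Finset.mem_Icc] at hb
  obtain ⟨r, ⟨hr1, hr2⟩, rfl⟩ := hb
  let bad : Finset (ZMod d) :=
    insert j (Finset.univ.filter fun k => d ≤ (i - k).val + (m + 1))
  have hbad : bad.card ≤ m + 2 := by
    refine (Finset.card_insert_le _ _).trans ?_
    have : (Finset.univ.filter fun k : ZMod d => d ≤ (i - k).val + (m + 1)).card ≤
        (Finset.Ico (d - (m + 1)) d).card := by
      refine Finset.card_le_card_of_injOn (fun k => (i - k).val) ?_ ?_
      · intro k hk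
        simp at hk
        have := ZMod.val_lt (i - k)
        simp
        omega
      · intro k _ k' _ h
        have := ZMod.val_injective d h
        simpa using this
    simp only [Nat.card_Ico] at this
    omega
  let B : Finset (VG d M) := Finset.disjSum Finset.univ
    ((bad ×ˢ Finset.univ) ∪ (Finset.univ ×ˢ Finset.univ.filter fun s : Fin M => s.val < d * d))
  have hB : B.card ≤ (m + 2) * M + d * (d * d) + d * d * (d * d + 1) := by
    rw [Finset.card_disjSum]
    have h1 := Finset.card_union_le (bad ×ˢ (Finset.univ : Finset (Fin M)))
      (Finset.univ ×ˢ Finset.univ.filter fun s : Fin M => s.val < d * d)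
    rw [Finset.card_product, Finset.card_product] at h1
    have h2 : (Finset.univ.filter fun s : Fin M => s.val < d * d).card ≤ d * d := by
      have := Finset.card_le_card_of_injOn (s := Finset.univ.filter fun s : Fin M => s.val < d * d)
        (t := Finset.range (d * d)) Fin.val (by intro s; simp) (Fin.val_injective.injOn)
      simpa using this
    have h3 := Nat.mul_le_mul_right M hbad
    have h4 := Nat.mul_le_mul_left d h2
    simp only [Finset.card_univ, ZMod.card, Fintype.card_fin, Fintype.card_prod] at h1 ⊢
    have : d * (d * (d * d + 1)) = d * d * (d * d + 1) := by ring
    omega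
  refine le_trans ?_ hB
  rw [← Set.ncard_coe_finset]
  refine Set.ncard_le_ncard ?_ (Set.toFinite _)
  intro v hv
  by_contra hvB
  apply hv
  rcases v with ⟨i', j', y⟩ | ⟨k, s⟩
  · exact (hvB (by simp [B])).elim
  · simp only [B, bad, Finset.mem_coe, Finset.inr_mem_disjSum, Finset.mem_union,
      Finset.mem_product, Finset.mem_univ, Finset.mem_filter, Finset.mem_insert, true_and,
      and_true, not_or, not_lt, not_le] at hvB
    obtain ⟨⟨hkj, hk⟩, hs⟩ := hvB
    have h1 := hij k hkj s
    have h2 := dist_base_le (by omega) (i + (r : ZMod d)) k s hs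
    have h3 : (i + (r : ZMod d) - k).val = (i - k).val + r := by
      have hrv : (r : ZMod d).val = r := ZMod.val_natCast_of_lt (by omega)
      rw [show i + (r : ZMod d) - k = (i - k) + r by ring, ZMod.val_add_of_lt (by omega), hrv]
    rw [h3] at h2
    have h4 : d * ((i - k).val + r) = d * (i - k).val + d * r := by ring
    have h5 : d * 1 ≤ d * r := Nat.mul_le_mul_left d hr1
    omega

theorem iso_dist {V W : Type*} {G : SimpleGraph V} {H : SimpleGraph W} (e : G ≃g H)
    (hG : G.Connected) (hH : H.Connected) (x y : V) : H.dist (e x) (e y) = G.dist x y := by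
  apply le_antisymm
  · obtain ⟨w, hw⟩ := hG.exists_walk_length_eq_dist x y
    rw [← hw, ← SimpleGraph.Walk.length_map (e : G →g H) w]
    exact SimpleGraph.dist_le _
  · obtain ⟨w, hw⟩ := hH.exists_walk_length_eq_dist (e x) (e y)
    rw [← hw, ← SimpleGraph.Walk.length_map (e.symm : H →g G) w]
    have := SimpleGraph.dist_le (w.map (e.symm : H →g G))
    simpa using this

theorem exists_graph (m : ℕ) (δ : ℝ) (hδ : 0 < δ) :
    ∃ (n : ℕ) (G : SimpleGraph (Fin n)), G.Connected ∧
      (∀ v, (G.neighborSet v).ncard ≤ 3) ∧ (∃ v, (G.neighborSet v).ncard = 3) ∧ m ≤ n ∧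
      ∀ (a : Fin n) (F : Finset (Fin n)), F.card ≤ m → ∃ b, b ∉ F ∧
        (({v | ¬ G.dist b v < G.dist a v} : Set (Fin n)).ncard : ℝ) ≤ δ * n := by
  classical
  obtain ⟨d0, hd0⟩ := exists_nat_ge (2 * (m + 2) / δ)
  set d := max d0 (m + 3) with hd
  have hd1 : m + 3 ≤ d := le_max_right _ _
  have hd2 : (d0 : ℝ) ≤ d := by exact_mod_cast le_max_left _ _
  have hNZ : NeZero d := ⟨by omega⟩
  clear_value d
  obtain ⟨M0, hM0⟩ := exists_nat_ge (2 * (d * (d * d) + d * d * (d * d + 1)) / δ : ℝ)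
  set M := max M0 (d * d) with hM
  have hM1 : d * d ≤ M := le_max_right _ _
  have hM2 : (M0 : ℝ) ≤ M := by exact_mod_cast le_max_left _ _
  clear_value M
  have e0 : VG d M ≃ Fin (Fintype.card (VG d M)) := Fintype.equivFin _
  have hcard : Fintype.card (VG d M) = d * d * (d * d + 1) + d * M := by
    simp [ZMod.card]; ring
  have hconn := connG (M := M) (d := d) (by omega) hM1
  set n := Fintype.card (VG d M) with hn
  clear_value n
  obtain ⟨H, ⟨e⟩⟩ : ∃ H : SimpleGraph (Fin n), Nonempty (graphG d M ≃g H) :=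
    ⟨_, ⟨SimpleGraph.Iso.map e0 _⟩⟩
  have hHc : H.Connected := e.connected_iff.1 hconn
  have hdeg : ∀ v, (H.neighborSet (e v)).ncard = ((graphG d M).neighborSet v).ncard := by
    intro v
    have : H.neighborSet (e v) = e '' ((graphG d M).neighborSet v) := by
      ext w
      obtain ⟨w, rfl⟩ := e.surjective w
      rw [e.injective.mem_set_image, SimpleGraph.mem_neighborSet, SimpleGraph.mem_neighborSet]
      exact e.map_adj_iff
    rw [this, Set.ncard_image_of_injective _ e.injective]
  refine ⟨n, H, hHc, ?_, ⟨_, (hdeg _).trans (deg_eqG (by omega) hM1)⟩, ?_, ?_⟩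
  · intro v
    obtain ⟨v, rfl⟩ := e.surjective v
    rw [hdeg]
    exact degG (by omega) hM1 v
  · nlinarith
  · intro a F hF
    obtain ⟨a, rfl⟩ := e.surjective a
    obtain ⟨b, hb, hle⟩ := coreG m d M hd1 hM1 a (F.image e.symm)
      (Finset.card_image_le.trans hF)
    refine ⟨e b, fun h => hb (Finset.mem_image.2 ⟨_, h, by simp⟩), ?_⟩
    have : ({v | ¬ H.dist (e b) v < H.dist (e a) v} : Set (Fin n)) =
        e '' {v | ¬ (graphG d M).dist b v < (graphG d M).dist a v} := by
      ext w
      obtain ⟨w, rfl⟩ := e.surjective w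
      simp [iso_dist e hconn hHc]
    rw [this, Set.ncard_image_of_injective _ e.injective]
    have hle' : (({v | ¬ (graphG d M).dist b v < (graphG d M).dist a v} : Set (VG d M)).ncard : ℝ)
        ≤ (m + 2) * M + (d * (d * d) + d * d * (d * d + 1)) := by
      rw [← add_assoc]; exact_mod_cast hle
    refine hle'.trans ?_
    have h1 : 2 * ((m : ℝ) + 2) ≤ d * δ := (div_le_iff₀ hδ).1 (hd0.trans hd2)
    have h2 := (div_le_iff₀ hδ).1 (hM0.trans hM2)
    have hdpos : (1 : ℝ) ≤ d := by exact_mod_cast (by omega : 1 ≤ d)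
    have hMpos : (0 : ℝ) ≤ M := by positivity
    have h3 : 2 * ((m : ℝ) + 2) * M ≤ d * δ * M := by gcongr
    have h4 : M * δ ≤ d * (M * δ) := le_mul_of_one_le_left (by positivity) hdpos
    have h5 : δ * (d * M) ≤ δ * n := by
      rw [hcard]; push_cast
      have : (0 : ℝ) ≤ d * d * (d * d + 1) := by positivity
      gcongr
      linarith
    nlinarith

theorem histList_length {V : Type*} (σ : List V → V) (a : ℕ → V) (k : ℕ) :
    (histList σ a k).length = 2 * k + 1 := by
  induction k with
  | zero => simp [histList]
  | succ k ih => simp [histList, ih]; omega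

theorem histList_last {V : Type*} (σ : List V → V) (a : ℕ → V) (k : ℕ) :
    (histList σ a k).getLast? = some (a k) := by
  cases k <;> simp [histList]

theorem mem_histList {V : Type*} (σ : List V → V) (a : ℕ → V) (k : ℕ) :
    (∀ j ≤ k, a j ∈ histList σ a k) ∧ (∀ j < k, bMove σ a j ∈ histList σ a k) := by
  induction k with
  | zero => simp [histList]
  | succ k ih =>
    refine ⟨fun j hj => ?_, fun j hj => ?_⟩
    · rcases Nat.lt_or_ge k j with h | h
      · obtain rfl : j = k + 1 := by omega
        simp [histList]
      · simp [histList, ih.1 j h]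
    · rcases Nat.lt_or_ge j k with h | h
      · simp [histList, ih.2 j h]
      · obtain rfl : j = k := by omega
        simp [histList, bMove]

theorem score_bound {n : ℕ} (G : SimpleGraph (Fin n)) (a b : ℕ → Fin n) (δ : ℝ) (k : ℕ)
    (hk : 1 ≤ k)
    (h : ∀ j < k, (({v | ¬ G.dist (b j) v < G.dist (a j) v} : Set (Fin n)).ncard : ℝ) ≤ δ * n) :
    (1 - k * δ) * n ≤ scoreB G ((Finset.range k).image a) ((Finset.range k).image b) := by
  classical
  let bad : Finset (Fin n) := (Finset.range k).biUnion
    fun j => Finset.univ.filter fun v => ¬ G.dist (b j) v < G.dist (a j) v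
  have hbad : (bad.card : ℝ) ≤ k * (δ * n) := by
    have h1 : (bad.card : ℝ) ≤ ∑ j ∈ Finset.range k,
        ((Finset.univ.filter fun v => ¬ G.dist (b j) v < G.dist (a j) v).card : ℝ) := by
      exact_mod_cast Finset.card_biUnion_le
    have h2 : ∑ j ∈ Finset.range k,
        ((Finset.univ.filter fun v => ¬ G.dist (b j) v < G.dist (a j) v).card : ℝ) ≤
        ∑ j ∈ Finset.range k, δ * n := by
      refine Finset.sum_le_sum fun j hj => ?_
      have := h j (Finset.mem_range.1 hj)
      rw [← Set.ncard_coe_finset]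
      simpa using this
    simpa using h1.trans h2
  have hgood : ∀ v ∈ badᶜ, distToSet G ((Finset.range k).image b) v <
      distToSet G ((Finset.range k).image a) v := by
    intro v hv
    simp only [bad, Finset.mem_compl, Finset.mem_biUnion, Finset.mem_filter, Finset.mem_univ,
      true_and, not_exists, not_and, not_not, Finset.mem_range] at hv
    obtain ⟨x, hx, hxe⟩ := Finset.exists_mem_eq_inf ((Finset.range k).image a)
      ⟨a 0, Finset.mem_image.2 ⟨0, Finset.mem_range.2 hk, rfl⟩⟩
      (fun x => (G.dist x v : ℕ∞))
    obtain ⟨j, hj, rfl⟩ := Finset.mem_image.1 hx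
    unfold distToSet
    rw [hxe]
    refine lt_of_le_of_lt (Finset.inf_le (Finset.mem_image_of_mem b hj)) ?_
    exact_mod_cast hv j (Finset.mem_range.1 hj)
  have hsum : ((badᶜ).card : ℝ) ≤
      scoreB G ((Finset.range k).image a) ((Finset.range k).image b) := by
    unfold scoreB
    rw [Finset.cast_card]
    refine (Finset.sum_le_sum fun v hv => ?_).trans
      (Finset.sum_le_sum_of_subset_of_nonneg (Finset.subset_univ (badᶜ)) fun v _ _ => ?_)
    · rw [if_pos (hgood v hv)]
    · split_ifs <;> norm_num
  refine le_trans ?_ hsum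
  have : (bad.card : ℝ) + (badᶜ).card = n := by
    have := Finset.card_add_card_compl bad
    rw [Fintype.card_fin] at this
    exact_mod_cast this
  nlinarith

/-- For every `t ≥ 1` and `ε > 0` there is a finite connected graph `G`
of maximum degree 3 with `2t ≤ |V(G)|` on which player B has a single strategy for the
`t`-round Voronoi game that always plays legally and, after each round `k = 1, …, t`,
would score at least `(1 − ε)·|V(G)|` if the unclaimed vertices were divided by the
Voronoi rule. -/
theorem voronoi_B_dominates_max_degree_three (t : ℕ) (ht : 1 ≤ t) (ε : ℝ) (hε : 0 < ε) :
    ∃ (n : ℕ) (G : SimpleGraph (Fin n)), G.Connected ∧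
      (∀ v, (G.neighborSet v).ncard ≤ 3) ∧ (∃ v, (G.neighborSet v).ncard = 3) ∧
      2 * t ≤ n ∧
      ∃ σ : List (Fin n) → Fin n,
        ∀ a : ℕ → Fin n,
          (∀ k < t, a k ∉ (Finset.range k).image a ∪ (Finset.range k).image (bMove σ a)) →
            (∀ k < t, bMove σ a k ∉
                insert (a k) ((Finset.range k).image a ∪ (Finset.range k).image (bMove σ a))) ∧
            (∀ k, 1 ≤ k → k ≤ t →
              (1 - ε) * n ≤
                scoreB G ((Finset.range k).image a) ((Finset.range k).image (bMove σ a))) := by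
  have htpos : (0 : ℝ) < t := by exact_mod_cast ht
  obtain ⟨n, G, hconn, hdeg, hdeg3, hn, hG⟩ := exists_graph (2 * t) (ε / t) (by positivity)
  refine ⟨n, G, hconn, hdeg, hdeg3, hn, ?_⟩
  have hne : Nonempty (Fin n) := hconn.nonempty
  have hstrat : ∀ l : List (Fin n), ∃ b, ∀ x, l.getLast? = some x → l.length ≤ 2 * t →
      b ∉ l ∧ (({v | ¬ G.dist b v < G.dist x v} : Set (Fin n)).ncard : ℝ) ≤ ε / t * n := by
    intro l
    by_cases hl : l.length ≤ 2 * t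
    · rcases hx : l.getLast? with _ | x
      · exact ⟨hne.some, by simp⟩
      · obtain ⟨b, hb, hb'⟩ := hG x l.toFinset ((List.toFinset_card_le l).trans hl)
        refine ⟨b, fun y hy _ => ?_⟩
        obtain rfl : x = y := by simpa using hy
        exact ⟨by simpa using hb, hb'⟩
    · exact ⟨hne.some, fun x _ h => (hl h).elim⟩
  choose σ hσ using hstrat
  refine ⟨σ, fun a _ => ?_⟩
  have hmove : ∀ k < t, bMove σ a k ∉ histList σ a k ∧
      (({v | ¬ G.dist (bMove σ a k) v < G.dist (a k) v} : Set (Fin n)).ncard : ℝ)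
        ≤ ε / t * n := fun k hk =>
    hσ (histList σ a k) (a k) (histList_last σ a k) (by rw [histList_length]; omega)
  refine ⟨fun k hk hmem => (hmove k hk).1 ?_, fun k hk1 hkt => ?_⟩
  · obtain ⟨ha, hb⟩ := mem_histList σ a k
    simp only [Finset.mem_insert, Finset.mem_union, Finset.mem_image, Finset.mem_range] at hmem
    rcases hmem with h | ⟨j, hj, h⟩ | ⟨j, hj, h⟩
    · rw [h]; exact ha k le_rfl
    · rw [← h]; exact ha j hj.le
    · rw [← h]; exact hb j hj
  · refine le_trans ?_ (score_bound G a (bMove σ a) (ε / t) k hk1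
      fun j hj => (hmove j (by omega)).2)
    have hkt' : (k : ℝ) ≤ t := by exact_mod_cast hkt
    have : (k : ℝ) * (ε / t) ≤ ε := by
      calc (k : ℝ) * (ε / t) ≤ t * (ε / t) := by gcongr
        _ = ε := by field_simp
    gcongr
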